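/- Zagier's formula: for any nonnegative integers r and s, H(r,s) = 2·∑_{k=1}^{r+s+1} (-1)^k · [C(2k, 2r+2) - (1 - 1/2^{2k})·C(2k, 2s+1)] · ζ(2k+1) · ζ({2}^{r+s+1-k}). -/

import Mathlib

/-- The multiple zeta value `ζ(s₁,…,s_l) = ∑_{1 ≤ k₁ < ⋯ < k_l} ∏ 1/kᵢ^{sᵢ}`. -/
noncomputable def MZV (s : List ℕ) : ℝ :=
  ∑' f : {f : Fin s.length → ℕ+ // StrictMono f},
    ∏ i : Fin s.length, (1 : ℝ) / ((f.1 i : ℕ) : ℝ) ^ s.get i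

/-- The multiple t-value `t(s₁,…,s_l) = ∑_{1 ≤ k₁ < ⋯ < k_l} ∏ 1/(2kᵢ-1)^{sᵢ}`. -/
noncomputable def MTV (s : List ℕ) : ℝ :=
  ∑' f : {f : Fin s.length → ℕ+ // StrictMono f},
    ∏ i : Fin s.length, (1 : ℝ) / ((2 * (f.1 i : ℕ) - 1 : ℕ) : ℝ) ^ s.get i

open Real Finset Filter Topology
open scoped ENNReal Nat

/-- The truncated sum `∑_{m < k₁ < ⋯ < k_l} ∏ 1/kᵢ^{sᵢ}`, valued in `ℝ≥0∞`. -/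
noncomputable def tailSum : List ℕ → ℕ → ℝ≥0∞
  | [], _ => 1
  | a :: l, m => ∑' n : ℕ, if m ≤ n then
      ENNReal.ofReal (1 / ((n + 1 : ℕ) : ℝ) ^ a) * tailSum l (n + 1) else 0

lemma strictMono_cons_and_lt_iff {n : ℕ} (m : ℕ) (k : ℕ+) (g : Fin n → ℕ+) :
    (StrictMono (Fin.cons k g : Fin (n + 1) → ℕ+) ∧
      ∀ i, m < ((Fin.cons k g : Fin (n + 1) → ℕ+) i : ℕ)) ↔
    m < (k : ℕ) ∧ (StrictMono g ∧ ∀ i, (k : ℕ) < g i) := by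
  constructor
  · rintro ⟨h1, h2⟩
    refine ⟨by simpa using h2 0, fun i j hij => ?_, fun i => ?_⟩
    · simpa using h1 (Fin.succ_lt_succ_iff.2 hij)
    · have := h1 (Fin.succ_pos i)
      simpa using this
  · rintro ⟨h1, h2, h3⟩
    refine ⟨?_, fun i => ?_⟩
    · intro i j hij
      induction j using Fin.cases with
      | zero => exact absurd hij (by simp)
      | succ j =>
        induction i using Fin.cases with
        | zero => simpa using h3 j
        | succ i => simpa using h2 (Fin.succ_lt_succ_iff.1 hij)
    · induction i using Fin.cases with
      | zero => simpa using h1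
      | succ i => simpa using h1.trans (h3 i)

open Classical in
lemma tsum_strictMono_eq_tailSum (s : List ℕ) (m : ℕ) :
    (∑' f : Fin s.length → ℕ+, if StrictMono f ∧ ∀ i, m < (f i : ℕ) then
      ENNReal.ofReal (∏ i, (1 : ℝ) / ((f i : ℕ) : ℝ) ^ s.get i) else 0) = tailSum s m := by
  induction s generalizing m with
  | nil =>
    rw [tailSum, tsum_eq_single (fun i => i.elim0)]
    · simp [Subsingleton.strictMono]
    · intro f hf
      exact absurd (funext fun i => i.elim0) hf
  | cons a l ih =>
    have key : (∑' f : Fin (l.length + 1) → ℕ+, if StrictMono f ∧ ∀ i, m < (f i : ℕ) then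
        ENNReal.ofReal (∏ i, (1 : ℝ) / ((f i : ℕ) : ℝ) ^ (a :: l).get i) else 0) =
        ∑' k : ℕ+, if m < (k : ℕ) then
          ENNReal.ofReal (1 / ((k : ℕ) : ℝ) ^ a) * tailSum l k else 0 := by
      rw [← (Fin.consEquiv (fun _ : Fin (l.length + 1) => ℕ+)).tsum_eq, ENNReal.tsum_prod']
      refine tsum_congr fun k => ?_
      simp only [Fin.consEquiv, Equiv.coe_fn_mk, strictMono_cons_and_lt_iff]
      split_ifs with hk
      · rw [← ih, ← ENNReal.tsum_mul_left]
        refine tsum_congr fun g => ?_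
        by_cases hg : StrictMono g ∧ ∀ i, (k : ℕ) < g i
        · rw [if_pos ⟨hk, hg⟩, if_pos hg, ← ENNReal.ofReal_mul (by positivity)]
          congr 1
          exact Fin.prod_univ_succ _
        · rw [if_neg fun h => hg h.2, if_neg hg, mul_zero]
      · simp [hk]
    refine key.trans ?_
    rw [tsum_pnat_eq_tsum_succ (f := fun k : ℕ => if m < k then
      ENNReal.ofReal (1 / (k : ℝ) ^ a) * tailSum l k else 0), tailSum]
    simp only [Nat.lt_succ_iff]

lemma MZV_eq_toReal_tailSum (s : List ℕ) : MZV s = (tailSum s 0).toReal := by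
  classical
  rw [← tsum_strictMono_eq_tailSum, ENNReal.tsum_toReal_eq]
  · refine (tsum_subtype {f : Fin s.length → ℕ+ | StrictMono f}
      (fun f => ∏ i : Fin s.length, (1 : ℝ) / ((f i : ℕ) : ℝ) ^ s.get i)).trans ?_
    refine tsum_congr fun f => ?_
    by_cases hf : StrictMono f
    · rw [Set.indicator_of_mem (by exact hf), if_pos ⟨hf, fun i => (f i).pos⟩,
        ENNReal.toReal_ofReal (by positivity)]
    · rw [Set.indicator_of_notMem (by exact hf), if_neg fun h => hf h.1, ENNReal.toReal_zero]
  · intro f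
    split_ifs <;> simp

/-- The divided power `(2x)ⁿ/n!`. -/
noncomputable def dpow (n : ℕ) (x : ℝ) : ℝ := (2 * x) ^ n / n !

lemma dpow_nonneg (n : ℕ) {x : ℝ} (hx : 0 ≤ x) : 0 ≤ dpow n x := by
  unfold dpow; positivity

lemma hasDerivAt_dpow_succ (n : ℕ) (x : ℝ) : HasDerivAt (dpow (n + 1)) (2 * dpow n x) x := by
  have h := (((hasDerivAt_id x).const_mul 2).pow (n + 1)).div_const ((n + 1)! : ℝ)
  refine h.congr_deriv ?_
  have : (n ! : ℝ) ≠ 0 := by positivity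
  simp only [dpow, Nat.factorial_succ, id]
  push_cast
  field_simp

@[fun_prop]
lemma continuous_dpow (n : ℕ) : Continuous (dpow n) := by
  unfold dpow; fun_prop

@[simp]
lemma dpow_zero_left (x : ℝ) : dpow 0 x = 1 := by simp [dpow]

@[simp]
lemma dpow_succ_zero (n : ℕ) : dpow (n + 1) 0 = 0 := by simp [dpow]

/-- The normalized Wallis integral `C(2m,m)/4^m`. -/
noncomputable def wallisRatio (m : ℕ) : ℝ := m.centralBinom / 4 ^ m

lemma wallisRatio_pos (m : ℕ) : 0 < wallisRatio m := by
  have := m.centralBinom_pos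
  unfold wallisRatio; positivity

@[simp]
lemma wallisRatio_zero : wallisRatio 0 = 1 := by simp [wallisRatio]

lemma wallisRatio_succ (m : ℕ) :
    wallisRatio (m + 1) = (2 * m + 1) / (2 * m + 2) * wallisRatio m := by
  have h : ((m : ℝ) + 1) * (m + 1).centralBinom = 2 * (2 * m + 1) * m.centralBinom := by
    exact_mod_cast Nat.succ_mul_centralBinom_succ m
  have : (m : ℝ) + 1 ≠ 0 := by positivity
  rw [wallisRatio, wallisRatio, pow_succ]
  field_simp
  linear_combination 2 * h

lemma hasDerivAt_cos_pow (n : ℕ) (x : ℝ) :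
    HasDerivAt (fun x => cos x ^ (n + 1)) (-((n + 1) * cos x ^ n * sin x)) x := by
  refine ((hasDerivAt_cos x).pow (n + 1)).congr_deriv ?_
  push_cast
  simp

lemma integral_mul_cos_pow_recurrence {p q g : ℝ → ℝ} (hp : ∀ x, HasDerivAt p (q x) x)
    (hq : ∀ x, HasDerivAt q (g x) x) (hg : Continuous g) (hq0 : q 0 = 0) (m : ℕ) :
    ∫ x in (0)..(π / 2), g x * cos x ^ (2 * (m + 1)) =
      (2 * m + 2) * (2 * m + 1) * (∫ x in (0)..(π / 2), p x * cos x ^ (2 * m)) -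
      (2 * m + 2) ^ 2 * ∫ x in (0)..(π / 2), p x * cos x ^ (2 * (m + 1)) := by
  have hpc : Continuous p := continuous_iff_continuousAt.2 fun x => (hp x).continuousAt
  have hderiv : ∀ x, HasDerivAt
      (fun x => q x * cos x ^ (2 * m + 1 + 1) + p x * ((2 * m + 2) * (cos x ^ (2 * m + 1) * sin x)))
      (g x * cos x ^ (2 * (m + 1)) - ((2 * m + 2) * (2 * m + 1) * (p x * cos x ^ (2 * m)) -
        (2 * m + 2) ^ 2 * (p x * cos x ^ (2 * (m + 1))))) x := by
    intro x
    refine (((hq x).mul (hasDerivAt_cos_pow (2 * m + 1) x)).add ((hp x).mul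
      (((hasDerivAt_cos_pow (2 * m) x).mul (hasDerivAt_sin x)).const_mul (2 * m + 2 : ℝ)))
      ).congr_deriv ?_
    push_cast [Pi.mul_apply]
    have h : sin x ^ 2 = 1 - cos x ^ 2 := by rw [← sin_sq_add_cos_sq x]; ring
    linear_combination (-(2 * m + 2) * (2 * m + 1) * p x * cos x ^ (2 * m)) * h
  have h := intervalIntegral.integral_eq_sub_of_hasDerivAt (a := 0) (b := π / 2)
    (fun x _ => hderiv x) (Continuous.intervalIntegrable (by fun_prop) _ _)
  rw [intervalIntegral.integral_sub (Continuous.intervalIntegrable (by fun_prop) _ _)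
    (Continuous.intervalIntegrable (by fun_prop) _ _),
    intervalIntegral.integral_sub (Continuous.intervalIntegrable (by fun_prop) _ _)
    (Continuous.intervalIntegrable (by fun_prop) _ _),
    intervalIntegral.integral_const_mul, intervalIntegral.integral_const_mul] at h
  simp only [cos_pi_div_two, hq0, sin_zero] at h
  linear_combination h

/-- The integral `∫₀^{π/2} (2x)^{2s}/(2s)! cos^{2m} x dx`. -/
noncomputable def cosMoment (s m : ℕ) : ℝ :=
  ∫ x in (0)..(π / 2), dpow (2 * s) x * cos x ^ (2 * m)

lemma cosMoment_zero_left (m : ℕ) : cosMoment 0 m = π / 2 * wallisRatio m := by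
  induction m with
  | zero => simp [cosMoment]
  | succ m ih =>
    have h := integral_mul_cos_pow_recurrence (p := fun _ => 1) (q := fun _ => 0) (g := fun _ => 0)
      (fun x => hasDerivAt_const _ _) (fun x => hasDerivAt_const _ _) continuous_const rfl m
    have e : ∀ n, cosMoment 0 n = ∫ x in (0)..(π / 2), 1 * cos x ^ (2 * n) := by
      simp [cosMoment]
    rw [← e, ← e, ih] at h
    rw [wallisRatio_succ]
    have : (m : ℝ) + 1 ≠ 0 := by positivity
    simp only [zero_mul, intervalIntegral.integral_zero] at h
    have h' : ((m : ℝ) + 1) * ((2 * m + 1) * (π / 2 * wallisRatio m) -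
      (2 * m + 2) * cosMoment 0 (m + 1)) = 0 := by linear_combination -h / 2
    have := (mul_eq_zero.1 h').resolve_left this
    field_simp
    linear_combination -2 * this

lemma cosMoment_succ (s m : ℕ) :
    4 * cosMoment s (m + 1) = (2 * m + 2) * (2 * m + 1) * cosMoment (s + 1) m -
      (2 * m + 2) ^ 2 * cosMoment (s + 1) (m + 1) := by
  have h := integral_mul_cos_pow_recurrence (p := dpow (2 * (s + 1)))
    (q := fun x => 2 * dpow (2 * s + 1) x) (g := fun x => 2 * (2 * dpow (2 * s) x))
    (fun x => hasDerivAt_dpow_succ _ x) (fun x => (hasDerivAt_dpow_succ _ x).const_mul 2)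
    (by fun_prop) (by simp) m
  rw [cosMoment, cosMoment, cosMoment, ← h, ← intervalIntegral.integral_const_mul]
  congr 1
  ext x
  ring

/-- The tail sum `∑_{m < k₁ < ⋯ < k_s} ∏ 1/kᵢ²`, as a normalized integral. -/
noncomputable def tailInt (s m : ℕ) : ℝ := cosMoment s m / (π / 2 * wallisRatio m)

lemma tailInt_zero_left (m : ℕ) : tailInt 0 m = 1 := by
  have := wallisRatio_pos m
  rw [tailInt, cosMoment_zero_left, div_self (by positivity)]

lemma tailInt_nonneg (s m : ℕ) : 0 ≤ tailInt s m := by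
  have := wallisRatio_pos m
  refine div_nonneg (intervalIntegral.integral_nonneg (by positivity) fun x hx => ?_)
    (by positivity)
  have : 0 ≤ cos x := cos_nonneg_of_mem_Icc ⟨by linarith [hx.1, pi_pos], hx.2⟩
  have := dpow_nonneg (2 * s) hx.1
  positivity

lemma tailInt_zero_right (s : ℕ) : tailInt s 0 = π ^ (2 * s) / (2 * s + 1)! := by
  have h : ∫ x in (0)..(π / 2), 2 * dpow (2 * s) x = dpow (2 * s + 1) (π / 2) - _ :=
    intervalIntegral.integral_eq_sub_of_hasDerivAt (a := 0) (b := π / 2)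
    (fun x _ => hasDerivAt_dpow_succ (2 * s) x)
    (Continuous.intervalIntegrable (by fun_prop) _ _)
  rw [dpow_succ_zero, intervalIntegral.integral_const_mul] at h
  have h2 : cosMoment s 0 = dpow (2 * s + 1) (π / 2) / 2 := by
    simp only [cosMoment, mul_zero, pow_zero, mul_one]
    linarith
  rw [tailInt, h2, dpow, wallisRatio_zero]
  have := pi_pos
  field_simp
  ring

lemma tailInt_sub (s m : ℕ) :
    tailInt (s + 1) m - tailInt (s + 1) (m + 1) = tailInt s (m + 1) / (m + 1) ^ 2 := by
  have h := cosMoment_succ s m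
  have := wallisRatio_pos m
  have := pi_pos
  have : (2 * (m : ℝ) + 1) ≠ 0 := by positivity
  have : (2 * (m : ℝ) + 2) ≠ 0 := by positivity
  have : ((m : ℝ) + 1) ≠ 0 := by positivity
  rw [tailInt, tailInt, tailInt, wallisRatio_succ]
  field_simp
  linear_combination (-(1 : ℝ) / 2) * h

lemma dpow_le_sin_sq (s : ℕ) {x : ℝ} (h0 : 0 ≤ x) (h1 : x ≤ π / 2) :
    dpow (2 * (s + 1)) x ≤ π ^ (2 * (s + 1)) * sin x ^ 2 := by
  have hs : 2 * x ≤ π * sin x := by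
    have := mul_le_sin h0 h1
    rw [div_mul_eq_mul_div, div_le_iff₀ pi_pos] at this
    linarith
  have hle : (2 * x) ^ (2 * s) ≤ π ^ (2 * s) := by gcongr; linarith
  calc dpow (2 * (s + 1)) x ≤ (2 * x) ^ (2 * (s + 1)) :=
        div_le_self (by positivity) (by exact_mod_cast Nat.one_le_iff_ne_zero.2 (by positivity))
    _ = (2 * x) ^ (2 * s) * (2 * x) ^ 2 := by ring
    _ ≤ π ^ (2 * s) * (π * sin x) ^ 2 := by gcongr
    _ = _ := by ring

lemma tailInt_succ_le (s m : ℕ) : tailInt (s + 1) m ≤ π ^ (2 * (s + 1)) * (1 / (2 * m + 2)) := by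
  have hw := wallisRatio_pos m
  have hpi := pi_pos
  rw [tailInt, div_le_iff₀ (by positivity)]
  have hle : cosMoment (s + 1) m ≤ ∫ x in (0)..(π / 2),
      π ^ (2 * (s + 1)) * (dpow (2 * 0) x * cos x ^ (2 * m) -
        dpow (2 * 0) x * cos x ^ (2 * (m + 1))) := by
    refine intervalIntegral.integral_mono_on (by positivity)
      (Continuous.intervalIntegrable (by fun_prop) _ _)
      (Continuous.intervalIntegrable (by fun_prop) _ _) fun x hx => ?_
    have hc : 0 ≤ cos x := cos_nonneg_of_mem_Icc ⟨by linarith [hx.1], hx.2⟩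
    calc dpow (2 * (s + 1)) x * cos x ^ (2 * m)
        ≤ π ^ (2 * (s + 1)) * sin x ^ 2 * cos x ^ (2 * m) := by
          gcongr; exact dpow_le_sin_sq s hx.1 hx.2
      _ = _ := by
          rw [sin_sq, mul_zero, dpow_zero_left]; ring
  rw [intervalIntegral.integral_const_mul, intervalIntegral.integral_sub
    (Continuous.intervalIntegrable (by fun_prop) _ _)
    (Continuous.intervalIntegrable (by fun_prop) _ _), ← cosMoment, ← cosMoment,
    cosMoment_zero_left, cosMoment_zero_left, wallisRatio_succ] at hle
  refine hle.trans_eq ?_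
  field_simp
  ring

lemma tendsto_tailInt_succ (s : ℕ) : Tendsto (tailInt (s + 1)) atTop (𝓝 0) := by
  refine squeeze_zero (tailInt_nonneg (s + 1)) (tailInt_succ_le s) ?_
  rw [← mul_zero (π ^ (2 * (s + 1)))]
  refine Tendsto.const_mul _ ?_
  refine squeeze_zero (fun m => by positivity) (fun m => ?_) tendsto_one_div_add_atTop_nhds_zero_nat
  gcongr
  · linarith [(m.cast_nonneg : (0 : ℝ) ≤ m)]
  · norm_num

lemma hasSum_tailInt (s m : ℕ) :
    HasSum (fun j : ℕ => tailInt s (m + j + 1) / ((m + j : ℕ) + 1 : ℝ) ^ 2)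
      (tailInt (s + 1) m) := by
  rw [hasSum_iff_tendsto_nat_of_nonneg
    fun j => div_nonneg (tailInt_nonneg s _) (by positivity)]
  have h : ∀ n, ∑ j ∈ range n, tailInt s (m + j + 1) / ((m + j : ℕ) + 1 : ℝ) ^ 2 =
      tailInt (s + 1) m - tailInt (s + 1) (n + m) := by
    intro n
    simp_rw [← tailInt_sub]
    rw [add_comm n m]
    exact sum_range_sub' (fun j => tailInt (s + 1) (m + j)) n
  simp_rw [h]
  simpa using tendsto_const_nhds.sub ((tendsto_add_atTop_iff_nat m).2 (tendsto_tailInt_succ s))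

/-- The elementary symmetric sum of degree `r` in `1/1², …, 1/n²`. -/
noncomputable def headSum : ℕ → ℕ → ℝ
  | 0, _ => 1
  | r + 1, n => ∑ k ∈ range n, headSum r k / ((k : ℝ) + 1) ^ 2

lemma headSum_nonneg (r n : ℕ) : 0 ≤ headSum r n := by
  induction r generalizing n with
  | zero => simp [headSum]
  | succ r ih =>
    rw [headSum]
    exact sum_nonneg fun k _ => div_nonneg (ih k) (by positivity)

lemma tsum_headSum_two_cons (i a : ℕ) (l : List ℕ) :
    ∑' k : ℕ, ENNReal.ofReal (headSum i k) *
        (ENNReal.ofReal (1 / ((k + 1 : ℕ) : ℝ) ^ 2) * tailSum (a :: l) (k + 1)) =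
      ∑' k : ℕ, ENNReal.ofReal (headSum (i + 1) k) *
        (ENNReal.ofReal (1 / ((k + 1 : ℕ) : ℝ) ^ a) * tailSum l (k + 1)) := by
  simp_rw [tailSum, ← ENNReal.tsum_mul_left]
  rw [ENNReal.tsum_comm]
  refine tsum_congr fun n => ?_
  rw [tsum_eq_sum (s := range n), headSum, ENNReal.ofReal_sum_of_nonneg, sum_mul]
  · refine sum_congr rfl fun k hk => ?_
    rw [if_pos (by have := mem_range.1 hk; omega), ← mul_assoc, ← ENNReal.ofReal_mul
      (headSum_nonneg i k)]
    simp [div_eq_mul_inv]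
  · exact fun k _ => div_nonneg (headSum_nonneg i k) (by positivity)
  · intro k hk
    rw [if_neg (by have := mt mem_range.2 hk; omega)]
    simp

lemma tsum_headSum_replicate (r i a : ℕ) (l : List ℕ) :
    ∑' k : ℕ, ENNReal.ofReal (headSum i k) *
        (ENNReal.ofReal (1 / ((k + 1 : ℕ) : ℝ) ^ 2) *
          tailSum (List.replicate r 2 ++ a :: l) (k + 1)) =
      ∑' k : ℕ, ENNReal.ofReal (headSum (i + r + 1) k) *
        (ENNReal.ofReal (1 / ((k + 1 : ℕ) : ℝ) ^ a) * tailSum l (k + 1)) := by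
  induction r generalizing i with
  | zero => exact tsum_headSum_two_cons i a l
  | succ r ih =>
    rw [List.replicate_succ, List.cons_append, tsum_headSum_two_cons, ih]
    congr! 6
    omega

lemma tailSum_replicate_append (r a : ℕ) (l : List ℕ) :
    tailSum (List.replicate r 2 ++ a :: l) 0 =
      ∑' k : ℕ, ENNReal.ofReal (headSum r k) *
        (ENNReal.ofReal (1 / ((k + 1 : ℕ) : ℝ) ^ a) * tailSum l (k + 1)) := by
  cases r with
  | zero => simp [tailSum, headSum]
  | succ r =>
    have h := tsum_headSum_replicate r 0 a l
    rw [Nat.zero_add] at h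
    rw [← h, List.replicate_succ, List.cons_append, tailSum]
    simp [headSum]

lemma headSum_le (r n : ℕ) : headSum r n ≤ (n : ℝ) ^ r := by
  induction r generalizing n with
  | zero => simp [headSum]
  | succ r ih =>
    rw [headSum]
    refine (sum_le_card_nsmul _ _ ((n : ℝ) ^ r) fun k hk => ?_).trans_eq ?_
    · have hkn : (k : ℝ) ≤ n := by exact_mod_cast (mem_range.1 hk).le
      refine (div_le_self (headSum_nonneg r k) ?_).trans ((ih k).trans (by gcongr))
      nlinarith [(k.cast_nonneg : (0 : ℝ) ≤ k)]
    · rw [card_range, nsmul_eq_mul, pow_succ']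

lemma one_le_succ_mul_wallisRatio (m : ℕ) : 1 ≤ (m + 1) * wallisRatio m := by
  induction m with
  | zero => simp
  | succ m ih =>
    have hw := wallisRatio_pos m
    rw [wallisRatio_succ]
    refine ih.trans ?_
    rw [← mul_assoc]
    gcongr
    push_cast
    rw [mul_div_assoc', le_div_iff₀ (by positivity)]
    nlinarith [(m.cast_nonneg : (0 : ℝ) ≤ m)]

/-- The partial sums of the expansion of `(2v)^{2r+2}/(2r+2)!` in powers of `sin² v`. -/
noncomputable def sinPartial (r M : ℕ) (v : ℝ) : ℝ :=
  ∑ k ∈ range M, headSum r k / ((k + 1) ^ 2 * wallisRatio (k + 1)) * sin v ^ (2 * k + 1 + 1)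

/-- The derivative of `sinPartial`. -/
noncomputable def sinPartialDeriv (r M : ℕ) (v : ℝ) : ℝ :=
  ∑ k ∈ range M, headSum r k / ((k + 1) ^ 2 * wallisRatio (k + 1)) *
    ((2 * k + 2) * (sin v ^ (2 * k + 1) * cos v))

lemma hasDerivAt_sin_pow (n : ℕ) (x : ℝ) :
    HasDerivAt (fun x => sin x ^ (n + 1)) ((n + 1) * sin x ^ n * cos x) x := by
  refine ((hasDerivAt_sin x).pow (n + 1)).congr_deriv ?_
  push_cast
  simp

lemma hasDerivAt_sinPartial (r M : ℕ) (v : ℝ) :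
    HasDerivAt (sinPartial r M) (sinPartialDeriv r M v) v := by
  unfold sinPartialDeriv
  refine HasDerivAt.fun_sum fun k _ =>
    ((hasDerivAt_sin_pow (2 * k + 1) v).const_mul _).congr_deriv ?_
  push_cast
  ring

lemma hasDerivAt_sinPartialDeriv (r M : ℕ) (v : ℝ) :
    HasDerivAt (sinPartialDeriv r M) (4 * ∑ k ∈ range M, headSum r k *
      (sin v ^ (2 * k) / wallisRatio k - sin v ^ (2 * (k + 1)) / wallisRatio (k + 1))) v := by
  rw [mul_sum]
  refine HasDerivAt.fun_sum fun k _ => ((((hasDerivAt_sin_pow (2 * k) v).mul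
    (hasDerivAt_cos v)).const_mul (2 * k + 2 : ℝ)).const_mul _).congr_deriv ?_
  have hw := wallisRatio_pos k
  have : (2 * (k : ℝ) + 1) ≠ 0 := by positivity
  have : ((k : ℝ) + 1) ≠ 0 := by positivity
  have h : cos v ^ 2 = 1 - sin v ^ 2 := by rw [← sin_sq_add_cos_sq v]; ring
  rw [wallisRatio_succ]
  push_cast
  field_simp
  rw [h]
  ring

lemma sum_headSum_zero_mul_sub (D : ℕ → ℝ) (M : ℕ) :
    ∑ k ∈ range M, headSum 0 k * (D k - D (k + 1)) = D 0 - D M := by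
  simpa [headSum] using sum_range_sub' D M

lemma sum_headSum_succ_mul_sub (D : ℕ → ℝ) (r M : ℕ) :
    ∑ k ∈ range M, headSum (r + 1) k * (D k - D (k + 1)) =
      ∑ k ∈ range M, headSum r k / ((k : ℝ) + 1) ^ 2 * D (k + 1) - headSum (r + 1) M * D M := by
  induction M with
  | zero => simp [headSum]
  | succ M ih =>
    have h : headSum (r + 1) (M + 1) = headSum (r + 1) M + headSum r M / ((M : ℝ) + 1) ^ 2 := by
      simp only [headSum, sum_range_succ]
    rw [sum_range_succ, ih, sum_range_succ, h]
    ring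

lemma nonneg_of_second_deriv_nonneg {f f' f'' : ℝ → ℝ} {b : ℝ} (hf : ∀ x, HasDerivAt f (f' x) x)
    (hf' : ∀ x, HasDerivAt f' (f'' x) x) (h0 : f 0 = 0) (h0' : f' 0 = 0)
    (h : ∀ x ∈ Set.Icc 0 b, 0 ≤ f'' x) : ∀ x ∈ Set.Icc 0 b, 0 ≤ f x := by
  have key : ∀ {g g' : ℝ → ℝ}, (∀ x, HasDerivAt g (g' x) x) → g 0 = 0 →
      (∀ x ∈ Set.Icc 0 b, 0 ≤ g' x) → ∀ x ∈ Set.Icc 0 b, 0 ≤ g x := by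
    intro g g' hg hg0 hg' x hx
    have hmono : MonotoneOn g (Set.Icc 0 b) := by
      refine monotoneOn_of_deriv_nonneg (convex_Icc 0 b)
        (fun x _ => (hg x).continuousAt.continuousWithinAt)
        (fun x _ => (hg x).differentiableAt.differentiableWithinAt) fun x hx => ?_
      rw [(hg x).deriv]
      exact hg' x (interior_subset hx)
    rw [← hg0]
    exact hmono ⟨le_rfl, hx.1.trans hx.2⟩ hx hx.1
  exact key hf h0 (key hf' h0' h)

lemma le_of_second_deriv_le {f f' f'' : ℝ → ℝ} {b c : ℝ} (hf : ∀ x, HasDerivAt f (f' x) x)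
    (hf' : ∀ x, HasDerivAt f' (f'' x) x) (h0 : f 0 = 0) (h0' : f' 0 = 0) (hc : 0 ≤ c)
    (h : ∀ x ∈ Set.Icc 0 b, f'' x ≤ 2 * c) : ∀ x ∈ Set.Icc 0 b, f x ≤ c * b ^ 2 := by
  intro x hx
  have := nonneg_of_second_deriv_nonneg (f := fun x => c * x ^ 2 - f x)
    (f' := fun x => 2 * c * x - f' x) (f'' := fun x => 2 * c - f'' x) (b := b)
    (fun x => (((hasDerivAt_pow 2 x).const_mul c).sub (hf x)).congr_deriv (by norm_num; ring))
    (fun x => (((hasDerivAt_id x).const_mul (2 * c)).sub (hf' x)).congr_deriv (by simp))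
    (by simp [h0]) (by simp [h0']) (fun x hx => sub_nonneg.2 (h x hx)) x hx
  have : c * x ^ 2 ≤ c * b ^ 2 := by
    have := hx.1
    have := hx.2
    gcongr
  linarith

/-- Bounds for the error term in the second derivative of `dpow (2 * r + 2) - sinPartial r M`. -/
lemma headSum_mul_sin_pow_bounds (r M : ℕ) {b v : ℝ} (hb : b < π / 2) (hv : v ∈ Set.Icc 0 b) :
    0 ≤ headSum r M * (sin v ^ (2 * M) / wallisRatio M) ∧
      headSum r M * (sin v ^ (2 * M) / wallisRatio M) ≤
        (M : ℝ) ^ r * ((M + 1) * (sin b ^ 2) ^ M) := by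
  have hw := wallisRatio_pos M
  have h0 := headSum_nonneg r M
  have hsv : 0 ≤ sin v := sin_nonneg_of_nonneg_of_le_pi hv.1 (by linarith [hv.2, pi_pos])
  have hsb : sin v ≤ sin b :=
    sin_le_sin_of_le_of_le_pi_div_two (by linarith [hv.1, pi_pos]) hb.le hv.2
  refine ⟨by positivity, ?_⟩
  refine mul_le_mul (headSum_le r M) ?_ (by positivity) (by positivity)
  rw [div_le_iff₀ hw, ← pow_mul]
  calc sin v ^ (2 * M) ≤ sin b ^ (2 * M) := by gcongr
    _ ≤ (M + 1) * wallisRatio M * sin b ^ (2 * M) :=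
      le_mul_of_one_le_left (by have := hsv.trans hsb; positivity) (one_le_succ_mul_wallisRatio M)
    _ = _ := by ring

lemma tendsto_headSum_bound (r : ℕ) {b : ℝ} (h0 : 0 ≤ b) (hb : b < π / 2) :
    Tendsto (fun M : ℕ => (M : ℝ) ^ r * ((M + 1) * (sin b ^ 2) ^ M)) atTop (𝓝 0) := by
  have hs : |sin b ^ 2| < 1 := by
    have hc : 0 < cos b := cos_pos_of_mem_Ioo ⟨by linarith [pi_pos], hb⟩
    rw [abs_of_nonneg (sq_nonneg _)]
    nlinarith [sin_sq_add_cos_sq b]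
  have := (tendsto_pow_const_mul_const_pow_of_abs_lt_one (r + 1) hs).add
    (tendsto_pow_const_mul_const_pow_of_abs_lt_one r hs)
  rw [add_zero] at this
  refine this.congr fun M => ?_
  ring

lemma exists_sinPartial_bound (r : ℕ) {b : ℝ} (h0 : 0 ≤ b) (hb : b < π / 2) :
    ∃ ε : ℕ → ℝ, Tendsto ε atTop (𝓝 0) ∧ ∀ M, ∀ v ∈ Set.Icc 0 b,
      0 ≤ dpow (2 * r + 2) v - sinPartial r M v ∧
      dpow (2 * r + 2) v - sinPartial r M v ≤ ε M := by
  have hd (r M : ℕ) (v : ℝ) := (hasDerivAt_dpow_succ (2 * r + 1) v).sub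
    (hasDerivAt_sinPartial r M v)
  have hd' (r M : ℕ) (v : ℝ) := ((hasDerivAt_dpow_succ (2 * r) v).const_mul 2).sub
    (hasDerivAt_sinPartialDeriv r M v)
  have hz (r M : ℕ) : (dpow (2 * r + 2) - sinPartial r M) 0 = 0 := by
    simp [sinPartial]
  have hz' (r M : ℕ) : 2 * dpow (2 * r + 1) 0 - sinPartialDeriv r M 0 = 0 := by
    simp [sinPartialDeriv]
  induction r with
  | zero =>
    refine ⟨fun M => 2 * ((M : ℝ) ^ 0 * ((M + 1) * (sin b ^ 2) ^ M)) * b ^ 2, ?_, fun M v hv => ?_⟩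
    · simpa using ((tendsto_headSum_bound 0 h0 hb).const_mul 2).mul_const (b ^ 2)
    have hB := fun x (hx : x ∈ Set.Icc 0 b) => headSum_mul_sin_pow_bounds 0 M hb hx
    have e (x : ℝ) := sum_headSum_zero_mul_sub (fun k => sin x ^ (2 * k) / wallisRatio k) M
    refine ⟨nonneg_of_second_deriv_nonneg (hd 0 M) (hd' 0 M) (hz 0 M) (hz' 0 M)
        (fun x hx => ?_) v hv,
      le_of_second_deriv_le (hd 0 M) (hd' 0 M) (hz 0 M) (hz' 0 M) ?_ (fun x hx => ?_) v hv⟩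
    · have := (hB x hx).1
      have := e x
      simp only [headSum, one_mul, mul_zero, pow_zero, wallisRatio_zero, dpow_zero_left] at *
      linarith
    · have := (hB v hv).1.trans (hB v hv).2
      positivity
    · have := (hB x hx).2
      have := e x
      simp only [headSum, one_mul, mul_zero, pow_zero, wallisRatio_zero, dpow_zero_left] at *
      linarith
  | succ r ih =>
    obtain ⟨ε, hε, hR⟩ := ih
    refine ⟨fun M => (2 * ε M + 2 * ((M : ℝ) ^ (r + 1) * ((M + 1) * (sin b ^ 2) ^ M))) * b ^ 2, ?_,
      fun M v hv => ?_⟩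
    · simpa using ((hε.const_mul 2).add
        ((tendsto_headSum_bound (r + 1) h0 hb).const_mul 2)).mul_const (b ^ 2)
    have hB := fun x (hx : x ∈ Set.Icc 0 b) => headSum_mul_sin_pow_bounds (r + 1) M hb hx
    have e (x : ℝ) : ∑ k ∈ range M, headSum (r + 1) k *
        (sin x ^ (2 * k) / wallisRatio k - sin x ^ (2 * (k + 1)) / wallisRatio (k + 1)) =
        sinPartial r M x - headSum (r + 1) M * (sin x ^ (2 * M) / wallisRatio M) := by
      rw [sum_headSum_succ_mul_sub (fun k => sin x ^ (2 * k) / wallisRatio k) r M, sinPartial]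
      congr 1
      refine sum_congr rfl fun k _ => ?_
      field_simp
      ring
    refine ⟨nonneg_of_second_deriv_nonneg (hd (r + 1) M) (hd' (r + 1) M) (hz _ M) (hz' _ M)
        (fun x hx => ?_) v hv,
      le_of_second_deriv_le (hd (r + 1) M) (hd' (r + 1) M) (hz _ M) (hz' _ M) ?_ (fun x hx => ?_)
        v hv⟩
    · have h1 := (hB x hx).1
      have h2 := (hR M x hx).1
      rw [e x, mul_add_one 2 r]
      linarith
    · have := (hB v hv).1.trans (hB v hv).2
      have := (hR M v hv).1.trans (hR M v hv).2
      positivity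
    · have h1 := (hB x hx).2
      have h2 := (hR M x hx).2
      rw [e x, mul_add_one 2 r]
      linarith

lemma hasSum_headSum_sin_pow (r : ℕ) {v : ℝ} (h0 : 0 ≤ v) (hv : v < π / 2) :
    HasSum (fun k : ℕ => headSum r k / ((k + 1) ^ 2 * wallisRatio (k + 1)) *
      sin v ^ (2 * k + 1 + 1)) (dpow (2 * r + 2) v) := by
  have hs : 0 ≤ sin v := sin_nonneg_of_nonneg_of_le_pi h0 (by linarith [pi_pos])
  rw [hasSum_iff_tendsto_nat_of_nonneg fun k => by
    have := wallisRatio_pos (k + 1)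
    have := headSum_nonneg r k
    positivity]
  obtain ⟨ε, hε, hR⟩ := exists_sinPartial_bound r h0 hv
  have h := squeeze_zero (fun M => (hR M v ⟨h0, le_rfl⟩).1) (fun M => (hR M v ⟨h0, le_rfl⟩).2) hε
  simpa [sinPartial] using (tendsto_const_nhds (x := dpow (2 * r + 2) v)).sub h

lemma cosMoment_eq_integral (s k : ℕ) :
    cosMoment s (k + 1) =
      (k + 1) * ∫ v in (0)..(π / 2),
        dpow (2 * s + 1) (π / 2 - v) * cos v * sin v ^ (2 * k + 1) := by
  have hderiv (x : ℝ) : HasDerivAt (fun x => dpow (2 * s + 1) x * cos x ^ (2 * k + 1 + 1))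
      (2 * (dpow (2 * s) x * cos x ^ (2 * (k + 1))) -
        2 * (k + 1) * (dpow (2 * s + 1) x * sin x * cos x ^ (2 * k + 1))) x := by
    refine ((hasDerivAt_dpow_succ (2 * s) x).mul (hasDerivAt_cos_pow (2 * k + 1) x)).congr_deriv ?_
    push_cast
    ring
  have h := intervalIntegral.integral_eq_sub_of_hasDerivAt (a := 0) (b := π / 2)
    (fun x _ => hderiv x) (Continuous.intervalIntegrable (by fun_prop) _ _)
  rw [intervalIntegral.integral_sub (Continuous.intervalIntegrable (by fun_prop) _ _)
    (Continuous.intervalIntegrable (by fun_prop) _ _),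
    intervalIntegral.integral_const_mul, intervalIntegral.integral_const_mul] at h
  simp only [cos_pi_div_two, dpow_succ_zero] at h
  have h2 := intervalIntegral.integral_comp_sub_left (a := 0) (b := π / 2)
    (fun x => dpow (2 * s + 1) x * sin x * cos x ^ (2 * k + 1)) (π / 2)
  simp only [sin_pi_div_two_sub, cos_pi_div_two_sub, sub_self, sub_zero] at h2
  rw [h2, cosMoment]
  simp only [ne_eq, Nat.add_eq_zero_iff, one_ne_zero, and_false, not_false_eq_true, zero_pow,
    mul_zero, zero_mul, sub_zero] at h
  linarith

/-- The integrand `(2v)^{2r+2}/(2r+2)! · (π-2v)^{2s+1}/(2s+1)! · cot v`. -/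
noncomputable def cotKernel (r s : ℕ) (v : ℝ) : ℝ :=
  dpow (2 * s + 1) (π / 2 - v) * cos v * (dpow (2 * r + 2) v / sin v)

lemma continuousOn_cotKernel (r s : ℕ) : ContinuousOn (cotKernel r s) (Set.Icc 0 (π / 2)) := by
  have h : cotKernel r s = fun v => dpow (2 * s + 1) (π / 2 - v) * cos v *
      (2 ^ (2 * r + 2) / (2 * r + 2)! * v ^ (2 * r + 1) * (sinc v)⁻¹) := by
    ext v
    rw [cotKernel]
    congr 1
    rw [dpow]
    by_cases hv : v = 0
    · simp [hv]
    · rw [sinc_of_ne_zero hv]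
      field_simp
      ring
  rw [h]
  have hs : ContinuousOn (fun v => (sinc v)⁻¹) (Set.Icc 0 (π / 2)) := by
    refine continuous_sinc.continuousOn.inv₀ fun v hv => ?_
    rcases hv.1.eq_or_lt with rfl | h0
    · simp
    · rw [sinc_of_ne_zero h0.ne']
      exact (div_pos (sin_pos_of_pos_of_lt_pi h0 (by linarith [hv.2, pi_pos])) h0).ne'
  fun_prop

lemma intervalIntegrable_cotKernel (r s : ℕ) :
    IntervalIntegrable (cotKernel r s) MeasureTheory.volume 0 (π / 2) := by
  refine ContinuousOn.intervalIntegrable ?_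
  rw [Set.uIcc_of_le (by positivity)]
  exact continuousOn_cotKernel r s

lemma hasSum_cotKernel (r s : ℕ) {v : ℝ} (h0 : 0 < v) (hv : v < π / 2) :
    HasSum (fun k : ℕ => headSum r k / ((k + 1) ^ 2 * wallisRatio (k + 1)) *
      (dpow (2 * s + 1) (π / 2 - v) * cos v * sin v ^ (2 * k + 1))) (cotKernel r s v) := by
  have hs : 0 < sin v := sin_pos_of_pos_of_lt_pi h0 (by linarith [pi_pos])
  refine (((hasSum_headSum_sin_pow r h0.le hv).div_const
    (sin v)).mul_left (dpow (2 * s + 1) (π / 2 - v) * cos v)).congr_fun fun k => ?_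
  rw [pow_succ _ (2 * k + 1), mul_div_assoc, mul_div_cancel_right₀ _ hs.ne']
  ring

lemma hasSum_headSum_mul_tailInt (r s : ℕ) :
    HasSum (fun k : ℕ => headSum r k * (1 / ((k + 1 : ℕ) : ℝ) ^ 3 * tailInt s (k + 1)))
      (2 / π * ∫ v in (0)..(π / 2), cotKernel r s v) := by
  have hne : ∀ᵐ v : ℝ, v ≠ π / 2 := by
    simp [MeasureTheory.ae_iff]
  have hterm (k : ℕ) : headSum r k * (1 / ((k + 1 : ℕ) : ℝ) ^ 3 * tailInt s (k + 1)) =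
      2 / π * ∫ v in (0)..(π / 2), headSum r k / ((k + 1) ^ 2 * wallisRatio (k + 1)) *
      (dpow (2 * s + 1) (π / 2 - v) * cos v * sin v ^ (2 * k + 1)) := by
    have := wallisRatio_pos (k + 1)
    have : ((k : ℝ) + 1) ≠ 0 := by positivity
    rw [intervalIntegral.integral_const_mul, tailInt, cosMoment_eq_integral]
    push_cast
    field_simp
  simp_rw [hterm]
  refine HasSum.mul_left _ ?_
  have hlim : ∀ᵐ v : ℝ, v ∈ Set.uIoc 0 (π / 2) → HasSum (fun k : ℕ =>
      headSum r k / ((k + 1) ^ 2 * wallisRatio (k + 1)) *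
      (dpow (2 * s + 1) (π / 2 - v) * cos v * sin v ^ (2 * k + 1))) (cotKernel r s v) := by
    filter_upwards [hne] with v hv hmem
    rw [Set.uIoc_of_le (by positivity)] at hmem
    exact hasSum_cotKernel r s hmem.1 (lt_of_le_of_ne hmem.2 hv)
  refine intervalIntegral.hasSum_integral_of_dominated_convergence
    (fun k v => headSum r k / ((k + 1) ^ 2 * wallisRatio (k + 1)) *
      (dpow (2 * s + 1) (π / 2 - v) * cos v * sin v ^ (2 * k + 1)))
    (fun k => Continuous.aestronglyMeasurable (by fun_prop)) (fun k => ?_) ?_ ?_ hlim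
  · refine Eventually.of_forall fun v hv => le_of_eq (norm_of_nonneg ?_)
    rw [Set.uIoc_of_le (by positivity)] at hv
    have := wallisRatio_pos (k + 1)
    have := headSum_nonneg r k
    have := dpow_nonneg (2 * s + 1) (sub_nonneg.2 hv.2)
    have : 0 ≤ cos v := cos_nonneg_of_mem_Icc ⟨by linarith [hv.1, pi_pos], hv.2⟩
    have : 0 ≤ sin v := sin_nonneg_of_nonneg_of_le_pi hv.1.le (by linarith [hv.2, pi_pos])
    positivity
  · filter_upwards [hlim] with v hv hmem using (hv hmem).summable
  · refine (intervalIntegrable_cotKernel r s).congr_ae ?_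
    rw [EventuallyEq, MeasureTheory.ae_restrict_iff' measurableSet_uIoc]
    filter_upwards [hlim] with v hv hmem using (hv hmem).tsum_eq.symm

/-- The Riemann-Lebesgue lemma on `[0, π/2]`, for the frequencies `2N`. -/
lemma tendsto_integral_mul_cos_sin {f : ℝ → ℝ}
    (hf : IntervalIntegrable f MeasureTheory.volume 0 (π / 2)) :
    Tendsto (fun N : ℕ => ∫ v in (0)..(π / 2), f v * cos (2 * N * v)) atTop (𝓝 0) ∧
    Tendsto (fun N : ℕ => ∫ v in (0)..(π / 2), f v * sin (2 * N * v)) atTop (𝓝 0) := by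
  set F : ℝ → ℂ := (Set.Ioc 0 (π / 2)).indicator fun v => (f v : ℂ) with hF
  have hN : Tendsto (fun N : ℕ => (N : ℝ) / π) atTop (cocompact ℝ) :=
    (tendsto_natCast_atTop_atTop.atTop_div_const pi_pos).mono_right atTop_le_cocompact
  have h := (Real.tendsto_integral_exp_smul_cocompact F).comp hN
  have hfourier (N : ℕ) : ∫ v : ℝ, Real.fourierChar (-(v * (N / π))) • F v =
      ((∫ v in (0)..(π / 2), f v * cos (2 * N * v) : ℝ) : ℂ) -
        ((∫ v in (0)..(π / 2), f v * sin (2 * N * v) : ℝ) : ℂ) * Complex.I := by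
    have e (v : ℝ) : Real.fourierChar (-(v * (N / π))) • F v =
        (Set.Ioc 0 (π / 2)).indicator (fun v => ((f v * cos (2 * N * v) : ℝ) : ℂ) -
          ((f v * sin (2 * N * v) : ℝ) : ℂ) * Complex.I) v := by
      by_cases hv : v ∈ Set.Ioc 0 (π / 2)
      · rw [hF, Set.indicator_of_mem hv, Set.indicator_of_mem hv, Circle.smul_def,
          Real.fourierChar_apply]
        have : ((2 * π * -(v * (N / π)) : ℝ) : ℂ) * Complex.I =
            ((-(2 * N * v) : ℝ) : ℂ) * Complex.I := by
          congr 2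
          field_simp
        rw [this, Complex.exp_mul_I, ← Complex.ofReal_cos, ← Complex.ofReal_sin, cos_neg, sin_neg]
        push_cast
        rw [smul_eq_mul]
        ring
      · rw [hF, Set.indicator_of_notMem hv, Set.indicator_of_notMem hv, smul_zero]
    have hc : IntervalIntegrable (fun v => f v * cos (2 * N * v)) MeasureTheory.volume 0 (π / 2) :=
      hf.mul_continuousOn (Continuous.continuousOn (by fun_prop))
    have hs : IntervalIntegrable (fun v => f v * sin (2 * N * v)) MeasureTheory.volume 0 (π / 2) :=
      hf.mul_continuousOn (Continuous.continuousOn (by fun_prop))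
    simp_rw [e]
    rw [MeasureTheory.integral_indicator measurableSet_Ioc,
      ← intervalIntegral.integral_of_le (by positivity), intervalIntegral.integral_sub,
      intervalIntegral.integral_mul_const, intervalIntegral.integral_ofReal,
      intervalIntegral.integral_ofReal]
    · exact ⟨hc.1.ofReal, hc.2.ofReal⟩
    · exact IntervalIntegrable.mul_const ⟨hs.1.ofReal, hs.2.ofReal⟩ _
  simp only [Function.comp_def, hfourier] at h
  constructor
  · simpa [Function.comp_def] using (Complex.continuous_re.tendsto 0).comp h
  · simpa [Function.comp_def] using ((Complex.continuous_im.tendsto 0).comp h).neg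

lemma two_mul_sum_sin (N : ℕ) (v : ℝ) :
    2 * (∑ n ∈ range N, sin (2 * (n + 1) * v)) * sin v =
      cos v * (1 - cos (2 * N * v)) + sin v * sin (2 * N * v) := by
  induction N with
  | zero => simp
  | succ N ih =>
    rw [sum_range_succ, mul_add, add_mul, ih]
    push_cast
    have e : 2 * ((N : ℝ) + 1) * v = 2 * N * v + 2 * v := by ring
    rw [e, sin_add, cos_add, sin_two_mul, cos_two_mul]
    have h : sin v ^ 2 = 1 - cos v ^ 2 := by rw [← sin_sq_add_cos_sq v]; ring
    linear_combination (2 * cos v * cos (2 * N * v)) * h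

open Polynomial in
lemma integral_eval_mul_sin (P : ℝ[X]) (n : ℕ) :
    ∫ v in (0)..(π / 2), P.eval (2 * v) * sin (2 * (n + 1) * v) =
      (P.eval 0 + (-1) ^ n * P.eval π) / (2 * (n + 1)) -
      (∫ v in (0)..(π / 2), (derivative^[2] P).eval (2 * v) * sin (2 * (n + 1) * v)) /
        (n + 1) ^ 2 := by
  have hn : (n : ℝ) + 1 ≠ 0 := by positivity
  have hP (Q : ℝ[X]) (v : ℝ) : HasDerivAt (fun v => Q.eval (2 * v))
      ((derivative Q).eval (2 * v) * 2) v :=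
    (Q.hasDerivAt (2 * v)).comp v (((hasDerivAt_id v).const_mul 2).congr_deriv (by simp))
  have hlin (v : ℝ) : HasDerivAt (fun v : ℝ => 2 * (n + 1) * v) (2 * (n + 1)) v := by
    simpa using (hasDerivAt_id v).const_mul (2 * ((n : ℝ) + 1))
  have hderiv (v : ℝ) : HasDerivAt (fun v => (derivative P).eval (2 * v) *
      sin (2 * (n + 1) * v) / (2 * (n + 1) ^ 2) -
        P.eval (2 * v) * cos (2 * (n + 1) * v) / (2 * (n + 1)))
      (P.eval (2 * v) * sin (2 * (n + 1) * v) +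
        (derivative^[2] P).eval (2 * v) * sin (2 * (n + 1) * v) / (n + 1) ^ 2) v := by
    refine ((((hP _ v).mul (hlin v).sin).div_const _).sub
      (((hP _ v).mul (hlin v).cos).div_const _)).congr_deriv ?_
    simp only [Function.iterate_succ, Function.iterate_zero, Function.comp, id]
    field_simp
    ring
  have h := intervalIntegral.integral_eq_sub_of_hasDerivAt (a := 0) (b := π / 2)
    (fun x _ => hderiv x) (Continuous.intervalIntegrable (by fun_prop) _ _)
  rw [intervalIntegral.integral_add (Continuous.intervalIntegrable (by fun_prop) _ _)
    (Continuous.intervalIntegrable (by fun_prop) _ _), intervalIntegral.integral_div] at h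
  have hs : sin (2 * ((n : ℝ) + 1) * (π / 2)) = 0 := by
    have := sin_nat_mul_pi (n + 1)
    push_cast at this
    rw [← this]; congr 1; ring
  have hc : cos (2 * ((n : ℝ) + 1) * (π / 2)) = -(-1) ^ n := by
    have := cos_nat_mul_pi (n + 1)
    push_cast at this
    rw [pow_succ, mul_neg_one] at this
    rw [← this]; congr 1; ring
  have h2 : 2 * (π / 2) = π := by ring
  rw [hs, hc, h2] at h
  simp only [mul_zero, sin_zero, cos_zero] at h
  rw [eq_sub_iff_add_eq, h]
  ring

open Polynomial in
lemma integral_eval_mul_sin_eq_sum (P : ℝ[X]) (n K : ℕ) :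
    ∫ v in (0)..(π / 2), P.eval (2 * v) * sin (2 * (n + 1) * v) =
      ∑ k ∈ range K, (-1) ^ k *
        ((derivative^[2 * k] P).eval 0 + (-1) ^ n * (derivative^[2 * k] P).eval π) /
          (2 * (n + 1) ^ (2 * k + 1)) +
      (-1) ^ K * (∫ v in (0)..(π / 2),
        (derivative^[2 * K] P).eval (2 * v) * sin (2 * (n + 1) * v)) / (n + 1) ^ (2 * K) := by
  have hn : (n : ℝ) + 1 ≠ 0 := by positivity
  induction K with
  | zero => simp
  | succ K ih =>
    rw [ih, sum_range_succ, integral_eval_mul_sin (derivative^[2 * K] P),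
      ← Function.iterate_add_apply,
      show 2 + 2 * K = 2 * (K + 1) by ring]
    field_simp
    ring

lemma tendsto_two_mul_integral_sin {g q : ℝ → ℝ}
    (hg : IntervalIntegrable g MeasureTheory.volume 0 (π / 2)) (hq : Continuous q)
    (h : ∀ v ∈ Set.Ioc 0 (π / 2), g v * sin v = q v * cos v) :
    Tendsto (fun N : ℕ => ∑ n ∈ range N, 2 * ∫ v in (0)..(π / 2), q v * sin (2 * (n + 1) * v))
      atTop (𝓝 (∫ v in (0)..(π / 2), g v)) := by
  have hqi : IntervalIntegrable q MeasureTheory.volume 0 (π / 2) := hq.intervalIntegrable _ _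
  have hlim := ((tendsto_const_nhds (x := ∫ v in (0)..(π / 2), g v)).sub
    (tendsto_integral_mul_cos_sin hg).1).add (tendsto_integral_mul_cos_sin hqi).2
  rw [sub_zero, add_zero] at hlim
  refine hlim.congr fun N => ?_
  have hc : IntervalIntegrable (fun v => g v * cos (2 * N * v)) MeasureTheory.volume 0 (π / 2) :=
    hg.mul_continuousOn (Continuous.continuousOn (by fun_prop))
  rw [← intervalIntegral.integral_sub hg hc, ← intervalIntegral.integral_add (hg.sub hc)
    (Continuous.intervalIntegrable (by fun_prop) _ _)]
  simp_rw [← intervalIntegral.integral_const_mul]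
  rw [← intervalIntegral.integral_finsetSum
    fun n _ => Continuous.intervalIntegrable (by fun_prop) _ _]
  refine intervalIntegral.integral_congr_ae (Eventually.of_forall fun v hv => ?_)
  rw [Set.uIoc_of_le (by positivity)] at hv
  have hs : sin v ≠ 0 := (sin_pos_of_pos_of_lt_pi hv.1 (by linarith [hv.2, pi_pos])).ne'
  refine mul_right_cancel₀ hs ?_
  have e : ∑ n ∈ range N, 2 * (q v * sin (2 * (n + 1) * v)) =
      q v * (2 * ∑ n ∈ range N, sin (2 * (n + 1) * v)) := by
    rw [mul_sum, mul_sum]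
    exact sum_congr rfl fun n _ => by ring
  rw [e, mul_assoc (q v), two_mul_sum_sin]
  linear_combination (1 - cos (2 * N * v)) * h v hv

/-- The value `ζ(k) = ∑ 1/(n+1)^k` as a real number. -/
noncomputable def zetaReal (k : ℕ) : ℝ := ∑' n : ℕ, 1 / ((n : ℝ) + 1) ^ k

lemma hasSum_zetaReal {k : ℕ} (hk : 2 ≤ k) :
    HasSum (fun n : ℕ => 1 / ((n : ℝ) + 1) ^ k) (zetaReal k) := by
  refine Summable.hasSum ?_
  have := (summable_nat_add_iff 1).2 (Real.summable_one_div_nat_pow.2 (show 1 < k by omega))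
  simpa using this

lemma hasSum_alternating_zetaReal {k : ℕ} (hk : 2 ≤ k + 1) :
    HasSum (fun n : ℕ => (-1) ^ n * (1 / ((n : ℝ) + 1) ^ (k + 1)))
      ((1 - 1 / 2 ^ k) * zetaReal (k + 1)) := by
  have h := hasSum_zetaReal hk
  have hdouble : HasSum (fun n : ℕ => (1 - (-1) ^ n) * (1 / ((n : ℝ) + 1) ^ (k + 1)))
      (0 + 2 * (1 / 2 ^ (k + 1) * zetaReal (k + 1))) := by
    refine HasSum.even_add_odd ?_ ?_
    · simp
    · refine ((h.mul_left (1 / 2 ^ (k + 1))).mul_left 2).congr_fun fun n => ?_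
      rw [pow_succ (-1 : ℝ), pow_mul]
      push_cast
      rw [show 2 * (n : ℝ) + 1 + 1 = 2 * (n + 1) by ring, mul_pow]
      have : (n : ℝ) + 1 ≠ 0 := by positivity
      field_simp
      norm_num
  have := h.sub hdouble
  rw [show (1 - 1 / 2 ^ k) * zetaReal (k + 1) =
      zetaReal (k + 1) - (0 + 2 * (1 / 2 ^ (k + 1) * zetaReal (k + 1))) by
    rw [pow_succ]; field_simp; ring]
  exact this.congr_fun fun n => by ring

lemma riemannZeta_eq_zetaReal {k : ℕ} (hk : 1 ≤ k) :
    riemannZeta (2 * k + 1) = (zetaReal (2 * k + 1) : ℂ) := by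
  have h := zeta_eq_tsum_one_div_nat_add_one_cpow (s := 2 * k + 1) (by
    have : (1 : ℝ) ≤ k := by exact_mod_cast hk
    simp; linarith)
  rw [h, zetaReal, Complex.ofReal_tsum]
  refine tsum_congr fun n => ?_
  push_cast
  norm_cast

open Polynomial in
lemma integral_eq_sum_zetaReal {g : ℝ → ℝ}
    (hg : IntervalIntegrable g MeasureTheory.volume 0 (π / 2)) (P : ℝ[X])
    (h : ∀ v ∈ Set.Ioc 0 (π / 2), g v * sin v = P.eval (2 * v) * cos v)
    (h0 : P.eval 0 = 0) (hpi : P.eval π = 0) {K : ℕ} (hK : P.natDegree < 2 * (K + 1)) :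
    ∫ v in (0)..(π / 2), g v = ∑ k ∈ Icc 1 K, (-1) ^ k *
      ((derivative^[2 * k] P).eval 0 + (1 - 1 / 2 ^ (2 * k)) * (derivative^[2 * k] P).eval π) *
        zetaReal (2 * k + 1) := by
  have h1 := tendsto_two_mul_integral_sin hg (q := fun v => P.eval (2 * v)) (by fun_prop) h
  have h2 : HasSum (fun n : ℕ => ∑ k ∈ Icc 1 K, (-1) ^ k *
      ((derivative^[2 * k] P).eval 0 * (1 / ((n : ℝ) + 1) ^ (2 * k + 1)) +
        (derivative^[2 * k] P).eval π * ((-1) ^ n * (1 / ((n : ℝ) + 1) ^ (2 * k + 1)))))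
      (∑ k ∈ Icc 1 K, (-1) ^ k * ((derivative^[2 * k] P).eval 0 * zetaReal (2 * k + 1) +
        (derivative^[2 * k] P).eval π * ((1 - 1 / 2 ^ (2 * k)) * zetaReal (2 * k + 1)))) := by
    refine hasSum_sum fun k hk => ?_
    have := (mem_Icc.1 hk).1
    exact (((hasSum_zetaReal (by omega)).mul_left _).add
      ((hasSum_alternating_zetaReal (by omega)).mul_left _)).mul_left _
  refine (tendsto_nhds_unique h1 ((h2.tendsto_sum_nat).congr fun N => sum_congr rfl fun n _ => ?_)
    ).trans (sum_congr rfl fun k _ => by ring)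
  rw [integral_eval_mul_sin_eq_sum P n (K + 1), iterate_derivative_eq_zero hK, range_eq_Ico,
    sum_eq_sum_Ico_succ_bot (by omega)]
  have e : Ico (0 + 1) (K + 1) = Icc 1 K := by ext; simp
  rw [e]
  simp only [mul_zero, Function.iterate_zero, id, h0, hpi, eval_zero, zero_mul, zero_div,
    intervalIntegral.integral_zero, add_zero, zero_add, mul_sum]
  refine sum_congr rfl fun k _ => ?_
  have : (n : ℝ) + 1 ≠ 0 := by positivity
  field_simp

lemma tailSum_replicate_two (s m : ℕ) :
    tailSum (List.replicate s 2) m = ENNReal.ofReal (tailInt s m) := by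
  induction s generalizing m with
  | zero => simp [tailSum, tailInt_zero_left]
  | succ s ih =>
    rw [List.replicate_succ, tailSum, ← (ENNReal.summable.sum_add_tsum_nat_add' (k := m)),
      sum_eq_zero fun n hn => if_neg (by have := mem_range.1 hn; omega), zero_add,
      ← (hasSum_tailInt s m).tsum_eq, ENNReal.ofReal_tsum_of_nonneg
        (fun j => div_nonneg (tailInt_nonneg s _) (by positivity)) (hasSum_tailInt s m).summable]
    refine tsum_congr fun j => ?_
    rw [if_pos (by omega), ih, ← ENNReal.ofReal_mul (by positivity), add_comm j m]
    push_cast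
    congr 1
    ring

lemma MZV_replicate_two (s : ℕ) :
    MZV (List.replicate s 2) = π ^ (2 * s) / (2 * s + 1)! := by
  rw [MZV_eq_toReal_tailSum, tailSum_replicate_two, ENNReal.toReal_ofReal (tailInt_nonneg s 0),
    tailInt_zero_right]

open Polynomial in
lemma eval_iterate_derivative_X_sub_pow_mul (c d : ℝ) {n a b : ℕ} (hn : n ≤ a + b) :
    (derivative^[n] ((X - C c) ^ a * (X - C d) ^ b)).eval c =
      n.choose a * (a ! * b ! / (a + b - n)! * (c - d) ^ (a + b - n)) := by
  have hterm (k : ℕ) (hk : n - k ≠ a) : (derivative^[n - k] ((X - C c) ^ a)).eval c = 0 := by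
    rw [iterate_derivative_X_sub_pow, eval_smul, eval_pow]
    rcases lt_or_gt_of_ne hk with h | h
    · simp [Nat.sub_ne_zero_of_lt h]
    · simp [Nat.descFactorial_of_lt h]
  rw [iterate_derivative_mul, eval_finsetSum]
  rcases lt_or_ge n a with h | h
  · rw [Nat.choose_eq_zero_of_lt h, Nat.cast_zero, zero_mul]
    refine sum_eq_zero fun k _ => ?_
    rw [eval_smul, eval_mul, hterm k (by omega), zero_mul, smul_zero]
  · rw [sum_eq_single (n - a)]
    · rw [eval_smul, eval_mul, show n - (n - a) = a by omega, iterate_derivative_X_sub_pow,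
        iterate_derivative_X_sub_pow, Nat.choose_symm h,
        show b - (n - a) = a + b - n by omega]
      have hd : (((a + b - n)! : ℕ) : ℝ) * b.descFactorial (n - a) = b ! := by
        rw [show a + b - n = b - (n - a) by omega]
        exact_mod_cast Nat.factorial_mul_descFactorial (by omega)
      rw [← hd]
      simp [Nat.descFactorial_self]
      field_simp
      simp
    · intro k hk hne
      have := mem_range.1 hk
      rw [eval_smul, eval_mul, hterm k (by omega), zero_mul, smul_zero]
    · intro h'
      exact absurd (mem_range.2 (by omega)) h'

open Polynomial in
lemma integral_cotKernel (r s : ℕ) :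
    ∫ v in (0)..(π / 2), cotKernel r s v = ∑ k ∈ Icc 1 (r + s + 1), (-1) ^ k *
      ((Nat.choose (2 * k) (2 * r + 2) : ℝ) -
        (1 - 1 / 2 ^ (2 * k)) * (Nat.choose (2 * k) (2 * s + 1) : ℝ)) *
      zetaReal (2 * k + 1) *
      (π ^ (2 * (r + s + 1 - k) + 1) / (2 * (r + s + 1 - k) + 1)!) := by
  set c : ℝ := -(1 / ((2 * r + 2)! * (2 * s + 1)!)) with hc
  set Q : ℝ[X] := (X - C 0) ^ (2 * r + 2) * (X - C π) ^ (2 * s + 1) with hQ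
  have hdeg : (C c * Q).natDegree < 2 * (r + s + 1 + 1) := by
    refine (natDegree_C_mul_le _ _).trans_lt (natDegree_mul_le.trans_lt ?_)
    rw [natDegree_pow, natDegree_pow, natDegree_X_sub_C, natDegree_X_sub_C]
    omega
  rw [integral_eq_sum_zetaReal (intervalIntegrable_cotKernel r s) (C c * Q) ?_ (by simp [hQ])
    (by simp [hQ]) hdeg]
  · refine sum_congr rfl fun k hk => ?_
    have hk' := (mem_Icc.1 hk).2
    rw [iterate_derivative_C_mul, eval_mul, eval_mul, eval_C, eval_C, hQ,
      eval_iterate_derivative_X_sub_pow_mul 0 π (by omega), mul_comm ((X - C 0) ^ (2 * r + 2)),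
      eval_iterate_derivative_X_sub_pow_mul π 0 (by omega),
      show 2 * r + 2 + (2 * s + 1) - 2 * k = 2 * (r + s + 1 - k) + 1 by omega,
      show 2 * s + 1 + (2 * r + 2) - 2 * k = 2 * (r + s + 1 - k) + 1 by omega, zero_sub,
      Odd.neg_pow ⟨_, rfl⟩, sub_zero, hc]
    field_simp
    ring
  · intro v hv
    have hs : sin v ≠ 0 := (sin_pos_of_pos_of_lt_pi hv.1 (by linarith [hv.2, pi_pos])).ne'
    have e : (π - 2 * v) ^ (2 * s + 1) = -(2 * v - π) ^ (2 * s + 1) := by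
      rw [← Odd.neg_pow ⟨_, rfl⟩, neg_sub]
    rw [cotKernel, dpow, dpow, show 2 * (π / 2 - v) = π - 2 * v by ring, e, hQ, hc]
    simp only [eval_mul, eval_C, eval_pow, eval_sub, eval_X, sub_zero]
    field_simp

theorem stmt_10 (r s : ℕ) :
    (MZV (List.replicate r 2 ++ 3 :: List.replicate s 2) : ℂ) =
      2 * ∑ k ∈ Finset.Icc 1 (r + s + 1),
        (-1) ^ k *
          ((Nat.choose (2 * k) (2 * r + 2) : ℂ) -
            (1 - 1 / 2 ^ (2 * k)) * (Nat.choose (2 * k) (2 * s + 1) : ℂ)) *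
          riemannZeta (2 * k + 1) * (MZV (List.replicate (r + s + 1 - k) 2) : ℂ) := by
  have hpi := pi_pos
  have hsum := hasSum_headSum_mul_tailInt r s
  have hH : MZV (List.replicate r 2 ++ 3 :: List.replicate s 2) =
      2 / π * ∫ v in (0)..(π / 2), cotKernel r s v := by
    rw [MZV_eq_toReal_tailSum, tailSum_replicate_append, ← hsum.tsum_eq, ENNReal.tsum_toReal_eq]
    · refine tsum_congr fun k => ?_
      rw [tailSum_replicate_two, ENNReal.toReal_mul, ENNReal.toReal_mul,
        ENNReal.toReal_ofReal (headSum_nonneg r k), ENNReal.toReal_ofReal (by positivity),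
        ENNReal.toReal_ofReal (tailInt_nonneg s _)]
    · intro k
      rw [tailSum_replicate_two]
      finiteness
  have hreal : MZV (List.replicate r 2 ++ 3 :: List.replicate s 2) =
      2 * ∑ k ∈ Icc 1 (r + s + 1), (-1) ^ k *
        ((Nat.choose (2 * k) (2 * r + 2) : ℝ) -
          (1 - 1 / 2 ^ (2 * k)) * (Nat.choose (2 * k) (2 * s + 1) : ℝ)) *
        zetaReal (2 * k + 1) * MZV (List.replicate (r + s + 1 - k) 2) := by
    rw [hH, integral_cotKernel, mul_sum, mul_sum]
    refine sum_congr rfl fun k _ => ?_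
    rw [MZV_replicate_two, pow_succ]
    field_simp
  rw [hreal]
  push_cast
  congr 1
  refine sum_congr rfl fun k hk => ?_
  rw [riemannZeta_eq_zetaReal (mem_Icc.1 hk).1]
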